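/- Let p be a prime and let G be a finite non-cyclic p-group. Then G has a cyclic subgroup of index p if and only if d(G) + 1 = D_o(G) = L(G) = |G|/p + p − 1 (all three equalities holding simultaneously). -/

import Mathlib

/-- A list (ordered sequence) over `G` is product-one free if no nonempty
order-preserving sublist has product equal to the identity. -/
def OrderedProductOneFree {G : Type*} [Group G] (l : List G) : Prop :=
  ∀ t : List G, t.Sublist l → t ≠ [] → t.prod ≠ 1

/-- The ordered Davenport constant: the smallest `k` such that every list of
elements of `G` of length at least `k` has a nonempty sublist with product one. -/
noncomputable def orderedDavenport (G : Type*) [Group G] : ℕ :=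
  sInf {k : ℕ | ∀ l : List G, k ≤ l.length → ¬ OrderedProductOneFree l}
/-- A multiset (sequence) over `G` is product-one free if no nonempty submultiset
admits an ordering of its terms whose product is the identity. -/
def ProductOneFreeM {G : Type*} [Group G] (s : Multiset G) : Prop :=
  ∀ t : Multiset G, t ≤ s → t ≠ 0 → ∀ l : List G, (l : Multiset G) = t → l.prod ≠ 1

/-- The small Davenport constant: the maximal cardinality of a product-one free
multiset over `G`. -/
noncomputable def smallDavenport (G : Type*) [Group G] : ℕ :=
  sSup {n : ℕ | ∃ s : Multiset G, ProductOneFreeM s ∧ Multiset.card s = n}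
/-- The Loewy length of a finite `p`-group `G`: the least positive integer `n` such that
the `n`-th power of the Jacobson radical of the group algebra `𝔽_p[G]` vanishes. -/
noncomputable def loewyLength (p : ℕ) (G : Type*) [Group G] : ℕ :=
  sInf {n : ℕ | 0 < n ∧ (Ideal.jacobson (⊥ : Ideal (MonoidAlgebra (ZMod p) G))) ^ n = ⊥}

theorem Submodule.pow_mul_le_mul_pow {F A : Type*} [CommRing F] [Ring A] [Algebra F A]
    {D I : Submodule F A} (h : D * I ≤ I * D) (k : ℕ) : D ^ k * I ≤ I * D ^ k := by
  induction k with
  | zero => simp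
  | succ k ih =>
    calc D ^ (k + 1) * I = D ^ k * (D * I) := by rw [pow_succ, mul_assoc]
      _ ≤ D ^ k * (I * D) := mul_le_mul' le_rfl h
      _ = D ^ k * I * D := by rw [mul_assoc]
      _ ≤ I * D ^ k * D := mul_le_mul' ih le_rfl
      _ = I * D ^ (k + 1) := by rw [pow_succ, mul_assoc]

theorem Submodule.pow_add_mul_le {F A : Type*} [CommRing F] [Ring A] [Algebra F A]
    {D I : Submodule F A} {k w : ℕ}
    (h : D ^ (k + w) ≤ I * D ^ k) (q : ℕ) : D ^ (k + w * q) ≤ I ^ q * D ^ k := by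
  induction q with
  | zero => simp
  | succ q ih =>
    calc D ^ (k + w * (q + 1)) = D ^ (k + w * q) * D ^ w := by rw [← pow_add]; congr 1; ring
      _ ≤ I ^ q * D ^ k * D ^ w := mul_le_mul' ih le_rfl
      _ = I ^ q * D ^ (k + w) := by rw [mul_assoc, pow_add]
      _ ≤ I ^ q * (I * D ^ k) := mul_le_mul' le_rfl h
      _ = I ^ (q + 1) * D ^ k := by rw [pow_succ, mul_assoc]

section TwoGenerators

variable {F A : Type*} [CommRing F] [Ring A] [Algebra F A] {D I : Submodule F A}

theorem Submodule.mul_pow_le_of_le (hI : I * ⊤ ≤ I) {a b : ℕ} (h : b ≤ a) :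
    I * D ^ a ≤ I * D ^ b := by
  obtain ⟨c, rfl⟩ := Nat.exists_eq_add_of_le' h
  rw [pow_add, ← mul_assoc]
  exact mul_le_mul' ((mul_le_mul' le_rfl le_top).trans hI) le_rfl

theorem Submodule.mul_pow_mul_top_le (hI : I * ⊤ ≤ I) (hD : D * ⊤ ≤ D) (k : ℕ) :
    I * D ^ k * ⊤ ≤ I * D ^ k := by
  cases k with
  | zero => simpa using hI
  | succ k =>
    rw [pow_succ, mul_assoc, mul_assoc]
    exact mul_le_mul' le_rfl (mul_le_mul' le_rfl hD)

theorem Submodule.pow_mul_mul_pow_le (h : D * I ≤ I * D) (i k : ℕ) :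
    D ^ i * (I * D ^ k) ≤ I * D ^ (i + k) := by
  rw [← mul_assoc, pow_add, ← mul_assoc]
  exact mul_le_mul' (Submodule.pow_mul_le_mul_pow h i) le_rfl

theorem Submodule.commutator_pow_mem {u v : A} {e : ℕ} (hDI : D * I ≤ I * D) (hv : v ∈ D)
    (huv : v * u - u * v ∈ I * D ^ e) (l : ℕ) :
    v ^ (l + 1) * u - u * v ^ (l + 1) ∈ I * D ^ (e + l) := by
  have key : ∀ l, v ^ l ∈ D ^ l := fun l => Submodule.pow_mem_pow D hv l
  induction l with
  | zero => simpa using huv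
  | succ l ih =>
    have e1 : v ^ (l + 1 + 1) * u - u * v ^ (l + 1 + 1)
        = v ^ 1 * (v ^ (l + 1) * u - u * v ^ (l + 1)) + (v * u - u * v) * v ^ (l + 1) := by
      rw [pow_succ' v (l + 1)]; noncomm_ring
    rw [e1]
    refine Submodule.add_mem _ ?_ ?_
    · have := Submodule.pow_mul_mul_pow_le hDI 1 (e + l) (Submodule.mul_mem_mul (key 1) ih)
      convert this using 3; omega
    · have := Submodule.mul_mem_mul huv (key (l + 1))
      rwa [mul_assoc, ← pow_add] at this

/-- Collection of monomials: modulo `I * D ^ (M - 2 + e)` the ideal `D ^ M` is generated by the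
monomials `u ^ i * v ^ l` with `i + l = M`. -/
theorem Submodule.pow_le_mul_pow_of_monomials {u v : A} {e M : ℕ}
    (hI : I * ⊤ ≤ I) (hD : D * ⊤ ≤ D) (hD' : ⊤ * D ≤ D)
    (hDI : D * I ≤ I * D) (hu : u ∈ D) (hv : v ∈ D)
    (hgen : D ≤ I ⊔ (F ∙ u) * ⊤ ⊔ (F ∙ v) * ⊤) (he : e ≤ 1) (hM : 2 ≤ M)
    (huv : v * u - u * v ∈ I * D ^ e)
    (hmon : ∀ i l, i + l = M → u ^ i * v ^ l ∈ I * D ^ (M - 2 + e)) :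
    D ^ M ≤ I * D ^ (M - 2 + e) := by
  set T := I * D ^ (M - 2 + e) with hT
  have hTtop : T * ⊤ ≤ T := Submodule.mul_pow_mul_top_le hI hD _
  have main : ∀ j i l, i + l + j = M → ∀ d ∈ D ^ j * ⊤, u ^ i * v ^ l * d ∈ T := by
    intro j
    induction j with
    | zero =>
      intro i l h d _
      exact hTtop (Submodule.mul_mem_mul (hmon i l (by omega)) trivial)
    | succ j ih =>
      intro i l h d hd
      have hui : u ^ i ∈ D ^ i := Submodule.pow_mem_pow D hu i
      have huivl : u ^ i * v ^ l ∈ D ^ (i + l) := by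
        rw [pow_add]; exact Submodule.mul_mem_mul hui (Submodule.pow_mem_pow D hv l)
      have htop : ∀ (r d : A), d ∈ D ^ j * ⊤ → r * d ∈ D ^ j * ⊤ := by
        intro r d hd
        cases j with
        | zero => simp
        | succ j =>
          have : (⊤ : Submodule F A) * (D ^ (j + 1) * ⊤) ≤ D ^ (j + 1) * ⊤ := by
            rw [pow_succ', mul_assoc, ← mul_assoc]
            exact mul_le_mul' hD' le_rfl
          exact this (Submodule.mul_mem_mul Submodule.mem_top hd)
      have hTj : ∀ a b : ℕ, M - 2 + e ≤ a + b → ∀ x ∈ I * D ^ a, ∀ y ∈ D ^ b * ⊤, x * y ∈ T := by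
        intro a b hab x hx y hy
        have h1 := Submodule.mul_mem_mul hx hy
        rw [← mul_assoc, mul_assoc I, ← pow_add] at h1
        exact hTtop (mul_le_mul' (Submodule.mul_pow_le_of_le hI hab) le_rfl h1)
      rw [pow_succ', mul_assoc] at hd
      induction hd using Submodule.mul_induction_on' with
      | add x hx y hy hx' hy' => rw [mul_add]; exact Submodule.add_mem _ hx' hy'
      | mem_mul_mem d₁ h₁ d₂ h₂ =>
        obtain ⟨y, hy, z, hz, rfl⟩ := Submodule.mem_sup.1 (hgen h₁)
        obtain ⟨i₀, hi₀, y', hy', rfl⟩ := Submodule.mem_sup.1 hy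
        obtain ⟨r, -, rfl⟩ := Submodule.mem_span_singleton_mul.1 hy'
        obtain ⟨s, -, rfl⟩ := Submodule.mem_span_singleton_mul.1 hz
        have e₁ : u ^ i * v ^ l * ((i₀ + u * r + v * s) * d₂)
            = u ^ i * v ^ l * i₀ * d₂ + u ^ i * (v ^ l * u - u * v ^ l) * (r * d₂)
              + u ^ (i + 1) * v ^ l * (r * d₂) + u ^ i * v ^ (l + 1) * (s * d₂) := by
          rw [pow_succ u, pow_succ v]; noncomm_ring
        rw [e₁]
        refine Submodule.add_mem _ (Submodule.add_mem _ (Submodule.add_mem _ ?_ ?_) ?_) ?_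
        · exact hTj (i + l) j (by omega) _ (Submodule.pow_mul_le_mul_pow hDI _
            (Submodule.mul_mem_mul huivl hi₀)) _ h₂
        · cases l with
          | zero => simp
          | succ l =>
            exact hTj (i + (e + l)) j (by omega) _ (Submodule.pow_mul_mul_pow_le hDI _ _
              (Submodule.mul_mem_mul hui (Submodule.commutator_pow_mem hDI hv huv l))) _
              (htop _ _ h₂)
        · exact ih (i + 1) l (by omega) _ (htop _ _ h₂)
        · exact ih i (l + 1) (by omega) _ (htop _ _ h₂)
  intro d hd
  have := main M 0 0 (by omega) d (by
    simpa using Submodule.mul_mem_mul hd (Submodule.mem_top : (1 : A) ∈ (⊤ : Submodule F A)))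
  simpa using this

end TwoGenerators

section GroupAlgebra

variable (p : ℕ) (G : Type*) [Group G]

/-- The augmentation ideal of `𝔽_p[G]`, as a subspace. -/
noncomputable def augmentationSubmodule : Submodule (ZMod p) (MonoidAlgebra (ZMod p) G) :=
  Submodule.span (ZMod p) (Set.range fun g : G => MonoidAlgebra.of (ZMod p) G g - 1)

variable {p G}

theorem of_sub_one_mem_augmentationSubmodule (g : G) :
    MonoidAlgebra.of (ZMod p) G g - 1 ∈ augmentationSubmodule p G :=
  Submodule.subset_span ⟨g, rfl⟩

theorem span_range_of_eq_top :
    Submodule.span (ZMod p) (Set.range (MonoidAlgebra.of (ZMod p) G)) = ⊤ := by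
  refine eq_top_iff.2 fun x _ => ?_
  induction x using MonoidAlgebra.induction_on with
  | of g => exact Submodule.subset_span ⟨g, rfl⟩
  | add x y hx hy => exact Submodule.add_mem _ (hx trivial) (hy trivial)
  | smul r x hx => exact Submodule.smul_mem _ _ (hx trivial)

theorem augmentationSubmodule_mul_top :
    augmentationSubmodule p G * ⊤ ≤ augmentationSubmodule p G := by
  rw [← span_range_of_eq_top, augmentationSubmodule, Submodule.span_mul_span, Submodule.span_le]
  rintro _ ⟨_, ⟨g, rfl⟩, _, ⟨h, rfl⟩, rfl⟩
  have e : (MonoidAlgebra.of (ZMod p) G g - 1) * MonoidAlgebra.of (ZMod p) G h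
      = (MonoidAlgebra.of (ZMod p) G (g * h) - 1) - (MonoidAlgebra.of (ZMod p) G h - 1) := by
    rw [map_mul]; noncomm_ring
  simp only [SetLike.mem_coe, e]
  exact Submodule.sub_mem _ (of_sub_one_mem_augmentationSubmodule _)
    (of_sub_one_mem_augmentationSubmodule _)

theorem top_mul_augmentationSubmodule :
    ⊤ * augmentationSubmodule p G ≤ augmentationSubmodule p G := by
  rw [← span_range_of_eq_top, augmentationSubmodule, Submodule.span_mul_span, Submodule.span_le]
  rintro _ ⟨_, ⟨g, rfl⟩, _, ⟨h, rfl⟩, rfl⟩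
  have e : MonoidAlgebra.of (ZMod p) G g * (MonoidAlgebra.of (ZMod p) G h - 1)
      = (MonoidAlgebra.of (ZMod p) G (g * h) - 1) - (MonoidAlgebra.of (ZMod p) G g - 1) := by
    rw [map_mul]; noncomm_ring
  simp only [SetLike.mem_coe, e]
  exact Submodule.sub_mem _ (of_sub_one_mem_augmentationSubmodule _)
    (of_sub_one_mem_augmentationSubmodule _)

theorem mem_augmentationSubmodule_of_lift_eq_zero {x : MonoidAlgebra (ZMod p) G}
    (hx : MonoidAlgebra.lift (ZMod p) (ZMod p) G 1 x = 0) : x ∈ augmentationSubmodule p G := by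
  have key : ∀ y : MonoidAlgebra (ZMod p) G,
      y - algebraMap _ _ (MonoidAlgebra.lift (ZMod p) (ZMod p) G 1 y)
        ∈ augmentationSubmodule p G := by
    intro y
    induction y using MonoidAlgebra.induction_on with
    | of g =>
      rw [MonoidAlgebra.lift_of]
      simpa [MonoidAlgebra.one_def] using of_sub_one_mem_augmentationSubmodule (p := p) g
    | add y z hy hz =>
      rw [map_add, map_add, add_sub_add_comm]
      exact Submodule.add_mem _ hy hz
    | smul r y hy =>
      rw [map_smul, smul_eq_mul, map_mul, ← Algebra.smul_def, ← smul_sub]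
      exact Submodule.smul_mem _ _ hy
  simpa [hx] using key x

theorem exists_prod_one_sub_eq_one_add (l : List G) :
    ∃ z ∈ Submodule.span (ZMod p)
        (MonoidAlgebra.of (ZMod p) G '' {g | ∃ t : List G, t.Sublist l ∧ t ≠ [] ∧ t.prod = g}),
      (l.map fun g => 1 - MonoidAlgebra.of (ZMod p) G g).prod = 1 + z := by
  induction l with
  | nil => exact ⟨0, Submodule.zero_mem _, by simp⟩
  | cons g l ih =>
    obtain ⟨z, hz, hprod⟩ := ih
    refine ⟨z - MonoidAlgebra.of (ZMod p) G g - MonoidAlgebra.of (ZMod p) G g * z, ?_, ?_⟩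
    · refine Submodule.sub_mem _ (Submodule.sub_mem _ ?_ ?_) ?_
      · refine Submodule.span_mono (Set.image_mono ?_) hz
        rintro _ ⟨t, ht, hne, rfl⟩
        exact ⟨t, ht.cons g, hne, rfl⟩
      · exact Submodule.subset_span ⟨g, ⟨[g], by simp⟩, rfl⟩
      · clear hprod
        induction hz using Submodule.span_induction with
        | zero => simp
        | add x y _ _ hx hy => rw [mul_add]; exact Submodule.add_mem _ hx hy
        | smul r x _ hx => rw [mul_smul_comm]; exact Submodule.smul_mem _ _ hx
        | mem x hx =>
          obtain ⟨_, ⟨t, ht, hne, rfl⟩, rfl⟩ := hx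
          rw [← map_mul]
          exact Submodule.subset_span ⟨_, ⟨g :: t, ht.cons_cons g, by simp, by simp⟩, rfl⟩
    · rw [List.map_cons, List.prod_cons, hprod]; noncomm_ring

theorem OrderedProductOneFree.prod_one_sub_ne_zero [Fact p.Prime] {l : List G}
    (hl : OrderedProductOneFree l) :
    (l.map fun g => 1 - MonoidAlgebra.of (ZMod p) G g).prod ≠ 0 := by
  obtain ⟨z, hz, hprod⟩ := exists_prod_one_sub_eq_one_add (p := p) l
  rw [hprod]
  intro h
  have hz0 : z.coeff 1 = 0 := by
    clear hprod h
    induction hz using Submodule.span_induction with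
    | zero => simp
    | add x y _ _ hx hy => simp [hx, hy]
    | smul r x _ hx => simp [hx]
    | mem x hx =>
      obtain ⟨_, ⟨t, ht, hne, rfl⟩, rfl⟩ := hx
      have := hl t ht hne
      simp [MonoidAlgebra.of_apply, this]
  have h1 := congrArg (fun x => x.coeff 1) h
  simp [hz0, MonoidAlgebra.one_def] at h1

theorem prod_one_sub_mem_pow (l : List G) :
    (l.map fun g => 1 - MonoidAlgebra.of (ZMod p) G g).prod
      ∈ augmentationSubmodule p G ^ l.length := by
  induction l with
  | nil => exact Submodule.one_le.1 le_rfl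
  | cons g l ih =>
    rw [List.map_cons, List.prod_cons, List.length_cons, pow_succ']
    refine Submodule.mul_mem_mul ?_ ih
    rw [← neg_sub]
    exact Submodule.neg_mem _ (of_sub_one_mem_augmentationSubmodule g)

theorem not_orderedProductOneFree_of_pow_eq_bot [Fact p.Prime] {m : ℕ}
    (hm : augmentationSubmodule p G ^ m = ⊥) {l : List G} (hl : m ≤ l.length) :
    ¬ OrderedProductOneFree l := by
  intro h
  obtain ⟨c, hc⟩ := Nat.exists_eq_add_of_le hl
  have := prod_one_sub_mem_pow (p := p) l
  rw [hc, pow_add, hm, Submodule.bot_mul, Submodule.mem_bot] at this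
  exact h.prod_one_sub_ne_zero this

theorem jacobson_bot_eq_augmentation [Fact p.Prime] {m : ℕ}
    (hm : augmentationSubmodule p G ^ m = ⊥) :
    (Ideal.jacobson (⊥ : Ideal (MonoidAlgebra (ZMod p) G))).restrictScalars (ZMod p)
      = augmentationSubmodule p G := by
  apply le_antisymm
  · intro x hx
    let ε : MonoidAlgebra (ZMod p) G →+* ZMod p :=
      (MonoidAlgebra.lift (ZMod p) (ZMod p) G 1 : MonoidAlgebra (ZMod p) G →ₐ[ZMod p] ZMod p)
    have hε : Function.Surjective ε := fun r => ⟨algebraMap _ _ r,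
      (MonoidAlgebra.lift (ZMod p) (ZMod p) G 1).commutes r⟩
    have := RingHom.ker_isMaximal_of_surjective ε hε
    have hx' : x ∈ RingHom.ker ε := (Submodule.mem_sInf.1 hx) _ ⟨bot_le, this⟩
    exact mem_augmentationSubmodule_of_lift_eq_zero hx'
  · intro x hx
    refine Ideal.mem_jacobson_iff.2 fun y => ?_
    have hyx : y * x ∈ augmentationSubmodule p G :=
      top_mul_augmentationSubmodule (Submodule.mul_mem_mul Submodule.mem_top hx)
    have hnil : IsNilpotent (y * x) := ⟨m, by
      have := Submodule.pow_mem_pow _ hyx m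
      rwa [hm, Submodule.mem_bot] at this⟩
    obtain ⟨w, hw⟩ := hnil.isUnit_one_add
    refine ⟨↑w⁻¹, ?_⟩
    have : (↑w⁻¹ : MonoidAlgebra (ZMod p) G) * y * x + ↑w⁻¹ - 1 = ↑w⁻¹ * (1 + y * x) - 1 := by
      noncomm_ring
    rw [this, ← hw]
    simp

theorem jacobson_bot_pow_eq_bot_iff [Fact p.Prime] {m : ℕ}
    (hm : augmentationSubmodule p G ^ m = ⊥) {n : ℕ} (hn : n ≠ 0) :
    Ideal.jacobson (⊥ : Ideal (MonoidAlgebra (ZMod p) G)) ^ n = ⊥ ↔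
      augmentationSubmodule p G ^ n = ⊥ := by
  rw [← jacobson_bot_eq_augmentation hm, ← Submodule.restrictScalars_pow hn,
    Submodule.restrictScalars_eq_bot_iff]

end GroupAlgebra

section CyclicNormal

variable {p : ℕ} {G : Type*} [Group G]

/-- The elements of `G` congruent to `1` modulo a right ideal of the group algebra. -/
def congruenceSubgroup (R : Submodule (ZMod p) (MonoidAlgebra (ZMod p) G)) (hR : R * ⊤ ≤ R) :
    Subgroup G where
  carrier := {g | MonoidAlgebra.of (ZMod p) G g - 1 ∈ R}
  one_mem' := by
    change MonoidAlgebra.of (ZMod p) G 1 - 1 ∈ R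
    rw [map_one, sub_self]
    exact Submodule.zero_mem R
  mul_mem' {g k} hg hk := by
    have e : MonoidAlgebra.of (ZMod p) G (g * k) - 1
        = (MonoidAlgebra.of (ZMod p) G g - 1) * MonoidAlgebra.of (ZMod p) G k
          + (MonoidAlgebra.of (ZMod p) G k - 1) := by rw [map_mul]; noncomm_ring
    change _ - 1 ∈ R
    rw [e]
    exact Submodule.add_mem _ (hR (Submodule.mul_mem_mul hg Submodule.mem_top)) hk
  inv_mem' {g} hg := by
    have e : MonoidAlgebra.of (ZMod p) G g⁻¹ - 1
        = -((MonoidAlgebra.of (ZMod p) G g - 1) * MonoidAlgebra.of (ZMod p) G g⁻¹) := by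
      rw [sub_mul, ← map_mul, mul_inv_cancel, map_one]; noncomm_ring
    change _ - 1 ∈ R
    rw [e]
    exact Submodule.neg_mem _ (hR (Submodule.mul_mem_mul hg Submodule.mem_top))

variable (p) in
/-- The right ideal of `𝔽_p[G]` generated by `h - 1`, as a subspace. -/
noncomputable def rightIdealOf (h : G) : Submodule (ZMod p) (MonoidAlgebra (ZMod p) G) :=
  (ZMod p ∙ (MonoidAlgebra.of (ZMod p) G h - 1)) * ⊤

theorem Submodule.top_mul_top_le {F A : Type*} [CommRing F] [Ring A] [Algebra F A]
    (R : Submodule F A) : R * ⊤ * ⊤ ≤ R * ⊤ := by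
  rw [mul_assoc]; exact mul_le_mul' le_rfl le_top

theorem rightIdealOf_mul_top (h : G) : rightIdealOf p h * ⊤ ≤ rightIdealOf p h :=
  Submodule.top_mul_top_le _

theorem of_sub_one_mul_mem_rightIdealOf (h : G) (x : MonoidAlgebra (ZMod p) G) :
    (MonoidAlgebra.of (ZMod p) G h - 1) * x ∈ rightIdealOf p h :=
  Submodule.mul_mem_mul (Submodule.mem_span_singleton_self _) Submodule.mem_top

theorem of_sub_one_mem_rightIdealOf {h n : G} (hn : n ∈ Subgroup.zpowers h) :
    MonoidAlgebra.of (ZMod p) G n - 1 ∈ rightIdealOf p h := by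
  have : Subgroup.zpowers h ≤ congruenceSubgroup (rightIdealOf p h) (rightIdealOf_mul_top h) := by
    rw [Subgroup.zpowers_le]
    change MonoidAlgebra.of (ZMod p) G h - 1 ∈ rightIdealOf p h
    simpa using of_sub_one_mul_mem_rightIdealOf (p := p) h 1
  exact this hn

theorem of_pow_sub_one [Fact p.Prime] (g : G) (m : ℕ) :
    MonoidAlgebra.of (ZMod p) G (g ^ p ^ m) - 1 = (MonoidAlgebra.of (ZMod p) G g - 1) ^ p ^ m := by
  have : CharP (MonoidAlgebra (ZMod p) G) p := charP_of_injective_algebraMap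
    (algebraMap (ZMod p) (MonoidAlgebra (ZMod p) G)).injective p
  rw [sub_pow_char_pow_of_commute _ _ (Commute.one_right _), one_pow, map_pow]

theorem of_pow_sub_one_mem [Fact p.Prime] {h n : G} (hn : n ∈ Subgroup.zpowers h) :
    MonoidAlgebra.of (ZMod p) G (n ^ p) - 1
      ∈ rightIdealOf p h * augmentationSubmodule p G ^ (p - 1) := by
  have := of_pow_sub_one (p := p) n 1
  rw [pow_one] at this
  rw [this, ← mul_pow_sub_one (Fact.out : p.Prime).ne_zero]
  exact Submodule.mul_mem_mul (of_sub_one_mem_rightIdealOf hn)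
    (Submodule.pow_mem_pow _ (of_sub_one_mem_augmentationSubmodule n) _)

theorem top_mul_rightIdealOf {h : G} (hN : (Subgroup.zpowers h).Normal) :
    ⊤ * rightIdealOf p h ≤ rightIdealOf p h := by
  rw [rightIdealOf, ← mul_assoc]
  refine (mul_le_mul' ?_ le_rfl).trans (rightIdealOf_mul_top h)
  rw [← span_range_of_eq_top, Submodule.span_mul_span, Submodule.span_le]
  rintro _ ⟨_, ⟨g, rfl⟩, _, rfl, rfl⟩
  have e : MonoidAlgebra.of (ZMod p) G g * (MonoidAlgebra.of (ZMod p) G h - 1)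
      = (MonoidAlgebra.of (ZMod p) G (g * h * g⁻¹) - 1) * MonoidAlgebra.of (ZMod p) G g := by
    rw [sub_mul, ← map_mul, mul_sub, ← map_mul]; simp
  simp only [SetLike.mem_coe, e]
  exact rightIdealOf_mul_top h (Submodule.mul_mem_mul
    (of_sub_one_mem_rightIdealOf (hN.conj_mem h (Subgroup.mem_zpowers h) g)) Submodule.mem_top)

theorem augmentationSubmodule_mul_rightIdealOf [Fact p.Prime] {h : G}
    (hN : (Subgroup.zpowers h).Normal)
    (hc : ∀ g : G, ∃ y ∈ Subgroup.zpowers h, g * h * g⁻¹ = h * y ^ p) :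
    augmentationSubmodule p G * rightIdealOf p h
      ≤ rightIdealOf p h * augmentationSubmodule p G := by
  have htop : rightIdealOf p h * augmentationSubmodule p G * ⊤
      ≤ rightIdealOf p h * augmentationSubmodule p G := by
    rw [mul_assoc]; exact mul_le_mul' le_rfl augmentationSubmodule_mul_top
  have htop' : ⊤ * (rightIdealOf p h * augmentationSubmodule p G)
      ≤ rightIdealOf p h * augmentationSubmodule p G := by
    rw [← mul_assoc]; exact mul_le_mul' (top_mul_rightIdealOf hN) le_rfl
  conv_lhs => rw [rightIdealOf, ← mul_assoc]
  refine (mul_le_mul' ?_ le_rfl).trans htop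
  rw [augmentationSubmodule, Submodule.span_mul_span, Submodule.span_le, ← augmentationSubmodule]
  rintro _ ⟨_, ⟨g, rfl⟩, _, rfl, rfl⟩
  obtain ⟨y, hy, hgy⟩ := hc g
  have hgh : g * h = h * y ^ p * g := by rw [← hgy]; group
  have e : (MonoidAlgebra.of (ZMod p) G g - 1) * (MonoidAlgebra.of (ZMod p) G h - 1)
      = MonoidAlgebra.of (ZMod p) G h *
          ((MonoidAlgebra.of (ZMod p) G (y ^ p) - 1) * MonoidAlgebra.of (ZMod p) G g)
        + (MonoidAlgebra.of (ZMod p) G h - 1) * (MonoidAlgebra.of (ZMod p) G g - 1) := by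
    have : MonoidAlgebra.of (ZMod p) G g * MonoidAlgebra.of (ZMod p) G h
        = MonoidAlgebra.of (ZMod p) G h * MonoidAlgebra.of (ZMod p) G (y ^ p)
          * MonoidAlgebra.of (ZMod p) G g := by rw [← map_mul, hgh, map_mul, map_mul]
    rw [sub_mul, mul_sub, this]; noncomm_ring
  simp only [SetLike.mem_coe, e]
  refine Submodule.add_mem _ (htop' (Submodule.mul_mem_mul Submodule.mem_top
    (htop (Submodule.mul_mem_mul ?_ Submodule.mem_top)))) (Submodule.mul_mem_mul
    (of_sub_one_mem_rightIdealOf (Subgroup.mem_zpowers h))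
    (of_sub_one_mem_augmentationSubmodule g))
  have h2 := (Fact.out : p.Prime).two_le
  simpa using Submodule.mul_pow_le_of_le (rightIdealOf_mul_top h) (b := 1) (by omega)
    (of_pow_sub_one_mem hy)

theorem rightIdealOf_pow_le {h : G} (hN : (Subgroup.zpowers h).Normal) (k : ℕ) :
    rightIdealOf p h ^ k ≤ (ZMod p ∙ (MonoidAlgebra.of (ZMod p) G h - 1) ^ k) * ⊤ := by
  induction k with
  | zero =>
    intro x _
    simpa using Submodule.mul_mem_mul (Submodule.mem_span_singleton_self
      (1 : MonoidAlgebra (ZMod p) G)) (Submodule.mem_top (x := x))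
  | succ k ih =>
    calc rightIdealOf p h ^ (k + 1)
        ≤ (ZMod p ∙ (MonoidAlgebra.of (ZMod p) G h - 1) ^ k) * ⊤ * rightIdealOf p h := by
          rw [pow_succ]; exact mul_le_mul' ih le_rfl
      _ ≤ (ZMod p ∙ (MonoidAlgebra.of (ZMod p) G h - 1) ^ k) * rightIdealOf p h := by
          rw [mul_assoc]; exact mul_le_mul' le_rfl (top_mul_rightIdealOf hN)
      _ = _ := by
          rw [rightIdealOf, ← mul_assoc, Submodule.span_mul_span, Set.singleton_mul_singleton,
            pow_succ]

theorem rightIdealOf_pow_eq_bot [Fact p.Prime] {h : G} (hN : (Subgroup.zpowers h).Normal) {m : ℕ}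
    (hm : h ^ p ^ m = 1) : rightIdealOf p h ^ p ^ m = ⊥ := by
  refine le_bot_iff.1 ((rightIdealOf_pow_le hN _).trans ?_)
  rw [← of_pow_sub_one, hm, map_one, sub_self, Submodule.span_zero_singleton, Submodule.bot_mul]

theorem augmentationSubmodule_le_of_closure {h a b : G} (hgen : Subgroup.closure {h, a, b} = ⊤) :
    augmentationSubmodule p G ≤ rightIdealOf p h
      ⊔ (ZMod p ∙ (MonoidAlgebra.of (ZMod p) G a - 1)) * ⊤
      ⊔ (ZMod p ∙ (MonoidAlgebra.of (ZMod p) G b - 1)) * ⊤ := by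
  rw [rightIdealOf, ← Submodule.sup_mul, ← Submodule.sup_mul]
  set R := ((ZMod p ∙ (MonoidAlgebra.of (ZMod p) G h - 1))
    ⊔ (ZMod p ∙ (MonoidAlgebra.of (ZMod p) G a - 1))
    ⊔ (ZMod p ∙ (MonoidAlgebra.of (ZMod p) G b - 1))) with hR
  have hle : R ≤ R * ⊤ := fun x hx => by
    simpa using Submodule.mul_mem_mul hx (Submodule.mem_top (x := (1 : MonoidAlgebra (ZMod p) G)))
  have : Subgroup.closure {h, a, b} ≤ congruenceSubgroup (R * ⊤) (Submodule.top_mul_top_le _) := by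
    rw [Subgroup.closure_le]
    rintro x (rfl | rfl | rfl)
    · exact hle (Submodule.mem_sup_left (Submodule.mem_sup_left
        (Submodule.mem_span_singleton_self _)))
    · exact hle (Submodule.mem_sup_left (Submodule.mem_sup_right
        (Submodule.mem_span_singleton_self _)))
    · exact hle (Submodule.mem_sup_right (Submodule.mem_span_singleton_self _))
  rw [hgen] at this
  rw [augmentationSubmodule, Submodule.span_le]
  rintro _ ⟨g, rfl⟩
  exact this (Subgroup.mem_top g)

theorem of_sub_one_pow_mem [Fact p.Prime] {h a y : G} (hy : y ∈ Subgroup.zpowers h)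
    (ha : a ^ p = y ^ p) : (MonoidAlgebra.of (ZMod p) G a - 1) ^ p
      ∈ rightIdealOf p h * augmentationSubmodule p G ^ (p - 1) := by
  have := of_pow_sub_one (p := p) a 1
  rw [pow_one] at this
  rw [← this, ha]
  exact of_pow_sub_one_mem hy

theorem augmentationSubmodule_pow_eq_bot_of_closure_pair [Fact p.Prime] {h a y : G}
    (hN : (Subgroup.zpowers h).Normal)
    (hc : ∀ g : G, ∃ y ∈ Subgroup.zpowers h, g * h * g⁻¹ = h * y ^ p)
    (hgen : Subgroup.closure {h, a} = ⊤) (hy : y ∈ Subgroup.zpowers h) (ha : a ^ p = y ^ p)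
    {m : ℕ} (hm : h ^ p ^ m = 1) : augmentationSubmodule p G ^ (p ^ m + p - 1) = ⊥ := by
  have h2 := (Fact.out : p.Prime).two_le
  have hgen' : Subgroup.closure {h, a, 1} = ⊤ := by
    rw [eq_top_iff, ← hgen]
    exact Subgroup.closure_mono (by rintro x (rfl | rfl) <;> simp)
  have hle := augmentationSubmodule_le_of_closure (p := p) hgen'
  rw [map_one, sub_self] at hle
  have key := Submodule.pow_le_mul_pow_of_monomials (e := 1) (M := p)
    (rightIdealOf_mul_top h) augmentationSubmodule_mul_top top_mul_augmentationSubmodule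
    (augmentationSubmodule_mul_rightIdealOf hN hc) (of_sub_one_mem_augmentationSubmodule a)
    (Submodule.zero_mem _) hle le_rfl h2 (by simp) (by
      intro i l hil
      rcases Nat.eq_zero_or_pos l with rfl | hl
      · rw [add_zero] at hil
        rw [pow_zero, mul_one, hil, show p - 2 + 1 = p - 1 by omega]
        exact of_sub_one_pow_mem hy ha
      · rw [zero_pow hl.ne', mul_zero]
        exact Submodule.zero_mem _)
  rw [show p - 2 + 1 = p - 1 by omega] at key
  have := Submodule.pow_add_mul_le (k := p - 1) (w := 1)
    (by rwa [Nat.sub_add_cancel (by omega)]) (p ^ m)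
  rw [rightIdealOf_pow_eq_bot hN hm, Submodule.bot_mul, le_bot_iff] at this
  rw [← this]
  congr 1
  omega

theorem augmentationSubmodule_pow_eq_bot_of_closure_triple [Fact p.Prime] {h a b c y z : G} {e : ℕ}
    (hN : (Subgroup.zpowers h).Normal)
    (hc : ∀ g : G, ∃ y ∈ Subgroup.zpowers h, g * h * g⁻¹ = h * y ^ p)
    (hgen : Subgroup.closure {h, a, b} = ⊤)
    (hy : y ∈ Subgroup.zpowers h) (ha : a ^ p = y ^ p)
    (hz : z ∈ Subgroup.zpowers h) (hb : b ^ p = z ^ p)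
    (hab : b * a = c * (a * b)) (he : e ≤ 1)
    (hce : MonoidAlgebra.of (ZMod p) G c - 1 ∈ rightIdealOf p h * augmentationSubmodule p G ^ e)
    {m : ℕ} (hm : h ^ p ^ m = 1) :
    augmentationSubmodule p G ^ (2 * p - 3 + e + (2 - e) * p ^ m) = ⊥ := by
  have h2 := (Fact.out : p.Prime).two_le
  have hDI := augmentationSubmodule_mul_rightIdealOf hN hc
  have hI := rightIdealOf_mul_top (p := p) h
  have hu := of_sub_one_mem_augmentationSubmodule (p := p) a
  have hv := of_sub_one_mem_augmentationSubmodule (p := p) b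
  have key := Submodule.pow_le_mul_pow_of_monomials (e := e) (M := 2 * p - 1) hI
    augmentationSubmodule_mul_top top_mul_augmentationSubmodule hDI hu hv
    (augmentationSubmodule_le_of_closure hgen) he (by omega) (by
      have e₁ : (MonoidAlgebra.of (ZMod p) G b - 1) * (MonoidAlgebra.of (ZMod p) G a - 1)
          - (MonoidAlgebra.of (ZMod p) G a - 1) * (MonoidAlgebra.of (ZMod p) G b - 1)
          = (MonoidAlgebra.of (ZMod p) G c - 1) * MonoidAlgebra.of (ZMod p) G (a * b) := by
        have : MonoidAlgebra.of (ZMod p) G b * MonoidAlgebra.of (ZMod p) G a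
            = MonoidAlgebra.of (ZMod p) G c * MonoidAlgebra.of (ZMod p) G (a * b) := by
          rw [← map_mul, hab, map_mul]
        rw [sub_mul _ 1, mul_sub, this, map_mul]
        noncomm_ring
      rw [e₁]
      exact Submodule.mul_pow_mul_top_le hI augmentationSubmodule_mul_top e
        (Submodule.mul_mem_mul hce Submodule.mem_top)) (by
      intro i l hil
      rcases le_or_gt p i with hi | hi
      · obtain ⟨i, rfl⟩ := Nat.exists_eq_add_of_le hi
        have h₁ := Submodule.mul_mem_mul (of_sub_one_pow_mem (p := p) hy ha)
          (Submodule.mul_mem_mul (Submodule.pow_mem_pow _ hu i) (Submodule.pow_mem_pow _ hv l))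
        rw [← mul_assoc (_ ^ p), ← pow_add, mul_assoc (rightIdealOf p h), ← pow_add,
          ← pow_add] at h₁
        exact Submodule.mul_pow_le_of_le hI (by omega) h₁
      · obtain ⟨l, rfl⟩ := Nat.exists_eq_add_of_le' (show p ≤ l by omega)
        have h₁ := Submodule.mul_mem_mul
          (Submodule.mul_mem_mul (Submodule.pow_mem_pow _ hu i) (Submodule.pow_mem_pow _ hv l))
          (of_sub_one_pow_mem (p := p) hz hb)
        rw [← pow_add] at h₁
        rw [pow_add _ l p, ← mul_assoc]
        exact Submodule.mul_pow_le_of_le hI (by omega)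
          (Submodule.pow_mul_mul_pow_le hDI _ _ h₁))
  rw [show 2 * p - 1 - 2 + e = 2 * p - 3 + e by omega] at key
  have := Submodule.pow_add_mul_le (k := 2 * p - 3 + e) (w := 2 - e)
    (by rwa [show 2 * p - 3 + e + (2 - e) = 2 * p - 1 by omega]) (p ^ m)
  rwa [rightIdealOf_pow_eq_bot hN hm, Submodule.bot_mul, le_bot_iff] at this

end CyclicNormal

section ZeroSum

variable {p : ℕ} [Fact p.Prime] {ι κ : Type*} [Fintype κ]

open MvPolynomial in
/-- Olson's bound for elementary abelian groups, via the Chevalley–Warning theorem. -/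
theorem exists_nonempty_subset_sum_eq_zero (a : κ → ι → ZMod p) {s : Finset ι}
    (hs : Fintype.card κ * (p - 1) < s.card) :
    ∃ t ⊆ s, t.Nonempty ∧ ∀ k, ∑ i ∈ t, a k i = 0 := by
  classical
  have hp := (Fact.out : p.Prime)
  let f : κ → MvPolynomial s (ZMod p) := fun k => ∑ i : s, a k i • X i ^ (p - 1)
  have hdeg : ∑ k, (f k).totalDegree < Fintype.card s := by
    calc ∑ k, (f k).totalDegree ≤ ∑ _k : κ, (p - 1) := by
          refine Finset.sum_le_sum fun k _ => totalDegree_finsetSum_le fun i _ => ?_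
          exact (totalDegree_smul_le ..).trans (totalDegree_X_pow ..).le
      _ < Fintype.card s := by simpa using hs
  have hp1 : p - 1 ≠ 0 := by have := hp.two_le; omega
  let zero_sol : {x : s → ZMod p // ∀ k, eval x (f k) = 0} :=
    ⟨0, fun k => by simp [f, map_sum, hp1]⟩
  have hdvd := char_dvd_card_solutions_of_fintype_sum_lt p hdeg
  have hpos : 0 < Fintype.card {x : s → ZMod p // ∀ k, eval x (f k) = 0} :=
    Fintype.card_pos_iff.2 ⟨zero_sol⟩
  obtain ⟨x, hx⟩ := Fintype.exists_ne_of_one_lt_card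
    (hp.one_lt.trans_le (Nat.le_of_dvd hpos hdvd)) zero_sol
  refine ⟨({i | x.1 i ≠ 0} : Finset s).map ⟨(↑), Subtype.val_injective⟩, ?_, ?_, fun k => ?_⟩
  · simp +contextual [Finset.subset_iff]
  · rw [← Subtype.coe_ne_coe, Function.ne_iff] at hx
    obtain ⟨i, hi⟩ := hx
    exact ⟨i, by simpa [zero_sol] using hi⟩
  · simpa [f, ZMod.pow_card_sub_one, Finset.sum_filter] using x.2 k

theorem exists_short_subset_sum_eq_zero (a : Fin 2 → ι → ZMod p) {s : Finset ι}
    (hs : 3 * p - 2 ≤ s.card) :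
    ∃ t ⊆ s, t.Nonempty ∧ t.card ≤ p ∧ ∀ k, ∑ i ∈ t, a k i = 0 := by
  classical
  have h2 := (Fact.out : p.Prime).two_le
  obtain ⟨s', hs', hcard⟩ := Finset.exists_subset_card_eq hs
  obtain ⟨t, hts, htne, ht⟩ := exists_nonempty_subset_sum_eq_zero
    (Fin.cons (fun _ => 1) a : Fin 3 → ι → ZMod p) (s := s')
    (by rw [hcard, Fintype.card_fin]; omega)
  have hta : ∀ k, ∑ i ∈ t, a k i = 0 := fun k => by simpa using ht k.succ
  have htp : p ∣ t.card := by
    rw [← CharP.cast_eq_zero_iff (ZMod p)]; simpa using ht 0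
  by_cases htc : t.card ≤ p
  · exact ⟨t, hts.trans hs', htne, htc, hta⟩
  obtain ⟨c, hc⟩ := htp
  have hle := Finset.card_le_card hts
  have hc2 : c = 2 := by
    have h1 : p * 1 < p * c := by omega
    have h3 : p * c < p * 3 := by omega
    have := Nat.lt_of_mul_lt_mul_left h1
    have := Nat.lt_of_mul_lt_mul_left h3
    omega
  subst hc2
  obtain ⟨r, hrt, hr⟩ := Finset.exists_subset_card_eq (s := t) (n := 2 * p - 1) (by omega)
  obtain ⟨q, hqr, hqne, hq⟩ := exists_nonempty_subset_sum_eq_zero a (s := r)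
    (by rw [hr, Fintype.card_fin]; omega)
  have hqt := hqr.trans hrt
  by_cases hqc : q.card ≤ p
  · exact ⟨q, hqt.trans (hts.trans hs'), hqne, hqc, hq⟩
  have hqle := Finset.card_le_card hqr
  have hdiff := Finset.card_sdiff_add_card_eq_card hqt
  refine ⟨t \ q, Finset.sdiff_subset.trans (hts.trans hs'), ?_, by omega, fun k => ?_⟩
  · rw [← Finset.card_pos]; omega
  · have := Finset.sum_sdiff (f := a k) hqt
    rw [hq k, add_zero] at this
    rw [this, hta k]

end ZeroSum

section Extraction

variable {p : ℕ} [Fact p.Prime] {G : Type*} [Group G] (f : Fin 2 → G →* Multiplicative (ZMod p))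

theorem exists_short_list_mem_ker (s : Multiset G) (hs : 3 * p - 2 ≤ Multiset.card s) :
    ∃ b : List G, b ≠ [] ∧ b.length ≤ p ∧ (b : Multiset G) ≤ s ∧ ∀ k, f k b.prod = 1 := by
  induction s using Quotient.inductionOn with | _ l
  obtain ⟨t, -, htne, htc, ht⟩ := exists_short_subset_sum_eq_zero
    (fun k (i : Fin l.length) => (f k (l.get i)).toAdd) (s := Finset.univ) (by simpa using hs)
  refine ⟨t.toList.map l.get, ?_, by simpa using htc, ?_, fun k => ?_⟩
  · simpa using htne.ne_empty
  · have h1 : t.val.map l.get ≤ (Finset.univ : Finset (Fin l.length)).val.map l.get :=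
      Multiset.map_le_map (Finset.val_le_iff.2 (Finset.subset_univ t))
    have h2 : (Finset.univ : Finset (Fin l.length)).val.map l.get = l := by
      simp
    rw [h2] at h1
    rwa [← Multiset.map_coe, Finset.coe_toList]
  · rw [map_list_prod, List.map_map, Finset.prod_map_toList]
    have := ht k
    rw [← toAdd_prod] at this
    exact this

theorem exists_blocks_mem_ker (N : Subgroup G) (hN : ∀ g, (∀ k, f k g = 1) → g ∈ N) (k : ℕ)
    (s : Multiset G) (hs : p * k + 2 * p - 2 ≤ Multiset.card s) :
    ∃ L : List {b : List G // b ≠ [] ∧ b.prod ∈ N}, L.length = k ∧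
      ((L.map Subtype.val).flatten : Multiset G) ≤ s := by
  classical
  induction k generalizing s with
  | zero => exact ⟨[], rfl, by simp⟩
  | succ k ih =>
    have h2 := (Fact.out : p.Prime).two_le
    rw [mul_add] at hs
    obtain ⟨b, hne, hlen, hbs, hb⟩ := exists_short_list_mem_ker f s
      (by have := Nat.zero_le (p * k); omega)
    obtain ⟨c, rfl⟩ := Multiset.le_iff_exists_add.1 hbs
    rw [Multiset.card_add, Multiset.coe_card] at hs
    obtain ⟨L, hL, hLs⟩ := ih c (by omega)
    refine ⟨⟨b, hne, hN _ hb⟩ :: L, by simp [hL], ?_⟩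
    rw [List.map_cons, List.flatten_cons, ← Multiset.coe_add]
    exact add_le_add le_rfl hLs

theorem not_productOneFreeM_of_subgroup (N : Subgroup G) (hN : ∀ g, (∀ k, f k g = 1) → g ∈ N)
    {k : ℕ} (hk : ∀ s : Multiset N, k ≤ Multiset.card s → ¬ ProductOneFreeM s)
    (s : Multiset G) (hs : p * k + 2 * p - 2 ≤ Multiset.card s) : ¬ ProductOneFreeM s := by
  obtain ⟨L, hL, hLs⟩ := exists_blocks_mem_ker f N hN k s hs
  let φ : {b : List G // b ≠ [] ∧ b.prod ∈ N} → N := fun b => ⟨b.1.prod, b.2.2⟩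
  have := hk (L.map φ) (by simp [hL])
  simp only [ProductOneFreeM, not_forall, not_not] at this
  obtain ⟨t, htL, ht0, l, rfl, hl⟩ := this
  obtain ⟨l', hl'l, hl'L⟩ := Multiset.coe_le.1 htL
  obtain ⟨L₁, hL₁, rfl⟩ := List.sublist_map_iff.1 hl'L
  obtain ⟨L₂, rfl, hL₂⟩ : ∃ L₂ : List _, l = L₂.map φ ∧ L₂.Perm L₁ := by
    have := congrFun₂ (List.eq_map_comp_perm φ) l L₁
    exact this.mpr hl'l.symm
  intro hfree
  refine hfree ((L₂.map Subtype.val).flatten : Multiset G) ?_ ?_ _ rfl ?_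
  · refine le_trans (Multiset.coe_le.2 ?_) hLs
    exact (hL₂.map _).flatten.subperm.trans (hL₁.map _).flatten.subperm
  · intro h0
    rw [Multiset.coe_eq_zero, List.flatten_eq_nil_iff] at h0
    match L₂ with
    | [] => simp_all
    | b :: _ => exact b.2.1 (h0 _ (by simp))
  · rw [List.prod_flatten, List.map_map]
    have h3 := congrArg (Subgroup.subtype N) hl
    rw [map_list_prod, List.map_map] at h3
    exact h3

end Extraction

section PGroup

theorem monoidHom_pow_eq_one {p : ℕ} {G : Type*} [Group G] (f : G →* Multiplicative (ZMod p))
    (g : G) : f (g ^ p) = 1 := by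
  rw [map_pow]
  exact Multiplicative.toAdd.injective (by simp)

theorem Subgroup.exists_monoidHom_ker_eq {p : ℕ} [Fact p.Prime] {G : Type*} [Group G]
    {M : Subgroup G} [M.Normal] (hM : M.index = p) :
    ∃ f : G →* Multiplicative (ZMod p), f.ker = M := by
  let e : G ⧸ M ≃* Multiplicative (ZMod p) := mulEquivOfPrimeCardEq (p := p) hM (by simp)
  refine ⟨e.toMonoidHom.comp (QuotientGroup.mk' M), ?_⟩
  ext g
  simp

variable {p : ℕ} [hp : Fact p.Prime] {G : Type*} [Group G] [Finite G]

theorem IsPGroup.exists_conj_eq_mul_pow (hG : IsPGroup p G) {h : G}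
    (hN : (Subgroup.zpowers h).Normal) (g : G) :
    ∃ y ∈ Subgroup.zpowers h, g * h * g⁻¹ = h * y ^ p := by
  obtain ⟨n, hn⟩ := hG.exists_card_eq
  obtain ⟨r, hr⟩ := hN.conj_mem h (Subgroup.mem_zpowers h) g
  change h ^ r = g * h * g⁻¹ at hr
  by_cases h1 : h = 1
  · exact ⟨1, one_mem _, by simp [h1]⟩
  have hpo : p ∣ orderOf h := by
    obtain ⟨k, hk⟩ := (Nat.dvd_prime_pow hp.out).1 (hn ▸ orderOf_dvd_natCard h)
    rw [hk.2]
    refine dvd_pow_self p fun hk0 => h1 ?_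
    rw [← orderOf_eq_one_iff, hk.2, hk0, pow_zero]
  have hconj : ∀ k : ℕ, g ^ k * h * (g ^ k)⁻¹ = h ^ r ^ k := by
    intro k
    induction k with
    | zero => simp
    | succ k ih =>
      calc g ^ (k + 1) * h * (g ^ (k + 1))⁻¹ = g * (g ^ k * h * (g ^ k)⁻¹) * g⁻¹ := by
            rw [pow_succ', mul_inv_rev]; simp only [mul_assoc]
        _ = h ^ r ^ (k + 1) := by rw [ih, ← conj_zpow, ← hr, ← zpow_mul, ← pow_succ']
  have hpow := hconj (p ^ n)
  rw [← hn, pow_card_eq_one', one_mul, inv_one, mul_one, hn] at hpow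
  have hmod : (r ^ p ^ n : ℤ) ≡ 1 [ZMOD p] := by
    refine Int.ModEq.of_dvd (Int.natCast_dvd_natCast.2 hpo) ?_
    rw [← zpow_eq_zpow_iff_modEq, ← hpow, zpow_one]
  rw [← ZMod.intCast_eq_intCast_iff, Int.cast_pow, ZMod.pow_card_pow,
    ZMod.intCast_eq_intCast_iff] at hmod
  obtain ⟨k, hk⟩ := hmod.symm.dvd
  refine ⟨h ^ k, ⟨k, rfl⟩, ?_⟩
  rw [← hr, ← zpow_natCast, ← zpow_mul, ← zpow_one_add, mul_comm k, ← hk]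
  congr 1; ring

theorem IsPGroup.exists_pow_eq_or_mem_zpowers (hG : IsPGroup p G) {h g : G}
    (hg : g ^ p ∈ Subgroup.zpowers h) :
    (∃ y ∈ Subgroup.zpowers h, g ^ p = y ^ p) ∨ h ∈ Subgroup.zpowers g := by
  obtain ⟨n, hn⟩ := hG.exists_card_eq
  obtain ⟨k, hk⟩ := hg
  change h ^ k = g ^ p at hk
  by_cases hpk : (p : ℤ) ∣ k
  · obtain ⟨m, rfl⟩ := hpk
    refine .inl ⟨h ^ m, ⟨m, rfl⟩, ?_⟩
    rw [← hk, mul_comm, zpow_mul, zpow_natCast]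
  · right
    have hcop : IsCoprime k ((p ^ n : ℕ) : ℤ) := by
      push_cast
      exact (((Nat.prime_iff_prime_int.1 hp.out).coprime_iff_not_dvd.2 hpk).symm).pow_right
    obtain ⟨u, v, huv⟩ := hcop
    have : h = (g ^ p) ^ u := by
      calc h = h ^ (u * k + v * ((p ^ n : ℕ) : ℤ)) := by rw [huv, zpow_one]
        _ = _ := by
          rw [zpow_add, mul_comm v, zpow_mul h _ v, zpow_natCast, ← hn, pow_card_eq_one',
            one_zpow, mul_one, mul_comm, zpow_mul, hk]
    rw [this]
    exact zpow_mem (pow_mem (Subgroup.mem_zpowers g) p) u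

theorem IsPGroup.normal_of_index_eq (hG : IsPGroup p G) {M : Subgroup G} (hM : M.index = p) :
    M.Normal := by
  obtain ⟨n, hn⟩ := hG.exists_card_eq
  refine Subgroup.normal_of_index_eq_minFac_card ?_
  have hn0 : n ≠ 0 := by
    rintro rfl
    have h1 := M.index_dvd_card
    rw [hn, hM, pow_zero, Nat.dvd_one] at h1
    exact hp.out.one_lt.ne' h1
  rw [hn, hp.out.pow_minFac hn0, hM]

theorem IsPGroup.exists_le_index_eq (hG : IsPGroup p G) {H : Subgroup G} (hH : H ≠ ⊤) :
    ∃ M : Subgroup G, H ≤ M ∧ M.index = p := by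
  obtain ⟨n, hn⟩ := hG.exists_card_eq
  obtain ⟨m, hm⟩ := (hG.to_subgroup H).exists_card_eq
  have hlt : m < n := by
    rw [← Nat.pow_lt_pow_iff_right hp.out.one_lt, ← hm, ← hn]
    exact (Subgroup.card_le_card_group H).lt_of_ne fun h => hH (Subgroup.eq_top_of_card_eq _ h)
  obtain ⟨K, hK, hHK⟩ := Sylow.exists_subgroup_card_pow_prime_le p (n := m) (m := n - 1)
    (by rw [hn]; exact pow_dvd_pow _ (by omega)) H hm (by omega)
  refine ⟨K, hHK, ?_⟩
  have h1 := K.card_mul_index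
  rw [hK, hn, ← Nat.sub_add_cancel (show 1 ≤ n by omega), pow_succ, Nat.add_sub_cancel] at h1
  exact Nat.eq_of_mul_eq_mul_left (pow_pos hp.out.pos _) h1

theorem IsPGroup.exists_two_monoidHom (hG : IsPGroup p G) (hnc : ¬ IsCyclic G) :
    ∃ (f : Fin 2 → G →* Multiplicative (ZMod p)) (a b : G),
      f 0 a ≠ 1 ∧ f 1 a = 1 ∧ f 0 b = 1 ∧ f 1 b ≠ 1 := by
  have hgen : ∀ g : G, Subgroup.zpowers g ≠ ⊤ := fun g h =>
    hnc (isCyclic_iff_exists_zpowers_eq_top.2 ⟨g, h⟩)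
  obtain ⟨M₁, -, h₁⟩ := hG.exists_le_index_eq (hgen 1)
  have hM₁ : M₁ ≠ ⊤ := by
    rintro rfl
    rw [Subgroup.index_top] at h₁
    exact hp.out.one_lt.ne h₁
  obtain ⟨a, ha⟩ : ∃ a, a ∉ M₁ := by
    by_contra! h
    exact hM₁ (eq_top_iff.2 fun x _ => h x)
  obtain ⟨M₂, haM₂, h₂⟩ := hG.exists_le_index_eq (hgen a)
  rw [Subgroup.zpowers_le] at haM₂
  obtain ⟨b, hb₁, hb₂⟩ : ∃ b ∈ M₁, b ∉ M₂ := by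
    by_contra! h
    have h3 := Subgroup.relIndex_mul_index h
    rw [h₁, h₂] at h3
    have h4 := Nat.eq_of_mul_eq_mul_right hp.out.pos (h3.trans (one_mul p).symm)
    exact ha (Subgroup.relIndex_eq_one.1 h4 haM₂)
  have := hG.normal_of_index_eq h₁
  have := hG.normal_of_index_eq h₂
  obtain ⟨f₁, rfl⟩ := Subgroup.exists_monoidHom_ker_eq h₁
  obtain ⟨f₂, rfl⟩ := Subgroup.exists_monoidHom_ker_eq h₂
  exact ⟨![f₁, f₂], a, b, ha, haM₂, hb₁, hb₂⟩

end PGroup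

section ElementaryQuotient

variable {p : ℕ} [hp : Fact p.Prime] {G : Type*} [Group G]
  {f : Fin 2 → G →* Multiplicative (ZMod p)} {a b : G}

theorem Subgroup.closure_pair_union_iInf_ker (h0a : f 0 a ≠ 1) (h1a : f 1 a = 1)
    (h0b : f 0 b = 1) (h1b : f 1 b ≠ 1) :
    closure {a, b} ⊔ (⨅ k, (f k).ker) = ⊤ := by
  refine eq_top_iff.2 fun g _ => ?_
  have hc : Nat.card (Multiplicative (ZMod p)) = p := by simp
  obtain ⟨i, hi⟩ := mem_zpowers_of_prime_card (g' := f 0 g) hc h0a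
  obtain ⟨j, hj⟩ := mem_zpowers_of_prime_card (g' := f 1 g) hc h1b
  change f 0 a ^ i = _ at hi
  change f 1 b ^ j = _ at hj
  rw [← mul_inv_cancel_left (a ^ i * b ^ j) g]
  refine mul_mem (mem_sup_left (mul_mem (zpow_mem (subset_closure (by simp)) _)
    (zpow_mem (subset_closure (by simp)) _))) (mem_sup_right ?_)
  simp only [mem_iInf, MonoidHom.mem_ker, Fin.forall_fin_two]
  simp [h0b, h1a, hi, hj]

theorem Subgroup.index_iInf_ker (h0a : f 0 a ≠ 1) (h1a : f 1 a = 1)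
    (h0b : f 0 b = 1) (h1b : f 1 b ≠ 1) : (⨅ k, (f k).ker).index = p ^ 2 := by
  have h : (⨅ k, (f k).ker) = ((f 0).prod (f 1)).ker := by
    ext g
    simp [mem_iInf, MonoidHom.mem_ker]
  have hsurj : Function.Surjective ((f 0).prod (f 1)) := by
    rintro ⟨u, v⟩
    have hc : Nat.card (Multiplicative (ZMod p)) = p := by simp
    obtain ⟨i, rfl⟩ := mem_zpowers_of_prime_card (g' := u) hc h0a
    obtain ⟨j, rfl⟩ := mem_zpowers_of_prime_card (g' := v) hc h1b
    exact ⟨a ^ i * b ^ j, by simp [h0b, h1a]⟩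
  rw [h, index_ker, MonoidHom.range_eq_top.2 hsurj, card_top, Nat.card_prod]
  simp [sq]

end ElementaryQuotient

section CyclicMaximal

variable {p : ℕ} [hp : Fact p.Prime] {G : Type*} [Group G]

theorem Subgroup.exists_notMem_of_index_eq {M : Subgroup G} (hM : M.index = p) :
    ∃ a, a ∉ M := by
  by_contra! hall
  rw [(eq_top_iff.2 fun x _ => hall x : M = ⊤), index_top] at hM
  exact hp.out.one_lt.ne hM

theorem Subgroup.mem_zpowers_comm_of_index_eq (hnc : ¬ IsCyclic G) {h : G}
    (hh : (zpowers h).index = p) {g : G} (hg : h ∈ zpowers g) : g ∈ zpowers h := by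
  have hle : zpowers h ≤ zpowers g := zpowers_le.2 hg
  have h1 := relIndex_mul_index hle
  rw [hh] at h1
  rcases (Nat.dvd_prime hp.out).1 (Dvd.intro_left _ h1) with h2 | h2
  · exact absurd (isCyclic_iff_exists_zpowers_eq_top.2 ⟨g, index_eq_one.1 h2⟩) hnc
  · rw [h2] at h1
    have h4 := Nat.eq_of_mul_eq_mul_right hp.out.pos (h1.trans (one_mul p).symm)
    exact relIndex_eq_one.1 h4 (mem_zpowers g)

theorem ProductOneFreeM.orderedProductOneFree {l : List G} (h : ProductOneFreeM (l : Multiset G)) :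
    OrderedProductOneFree l :=
  fun t ht hne => h t (Multiset.coe_le.2 ht.subperm) (by simpa using hne) t rfl

theorem not_productOneFreeM_of_pow_eq_bot {m : ℕ} (hm : augmentationSubmodule p G ^ m = ⊥)
    {s : Multiset G} (hs : m ≤ Multiset.card s) : ¬ ProductOneFreeM s := by
  induction s using Quotient.inductionOn with | _ l
  exact fun h => not_orderedProductOneFree_of_pow_eq_bot hm hs h.orderedProductOneFree

theorem MonoidHom.map_list_prod_eq_pow_count {G M : Type*} [Group G] [Monoid M] [DecidableEq G]
    (f : G →* M) {h a : G} (hfh : f h = 1) (hne : h ≠ a) (l : List G)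
    (hl : ∀ x ∈ l, x = h ∨ x = a) : f l.prod = f a ^ l.count a := by
  induction l with
  | nil => simp
  | cons x l ih =>
    rw [List.prod_cons, map_mul, ih fun y hy => hl y (List.mem_cons_of_mem _ hy)]
    rcases hl x List.mem_cons_self with rfl | rfl
    · rw [hfh, one_mul, List.count_cons_of_ne hne]
    · rw [List.count_cons_self, pow_succ']

variable [Finite G]

theorem IsPGroup.exists_pow_eq_pow (hG : IsPGroup p G) {h g : G}
    (hgp : g ^ p ∈ Subgroup.zpowers h) (hg : h ∈ Subgroup.zpowers g → g ∈ Subgroup.zpowers h) :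
    ∃ y ∈ Subgroup.zpowers h, g ^ p = y ^ p := by
  rcases hG.exists_pow_eq_or_mem_zpowers hgp with h1 | h1
  · exact h1
  · exact ⟨g, hg h1, rfl⟩

theorem IsPGroup.augmentationSubmodule_pow_eq_bot_of_index_eq (hG : IsPGroup p G)
    (hnc : ¬ IsCyclic G) {h : G} (hh : (Subgroup.zpowers h).index = p) :
    augmentationSubmodule p G ^ (Nat.card G / p + p - 1) = ⊥ := by
  have hN := hG.normal_of_index_eq hh
  obtain ⟨m, hm⟩ := (hG.to_subgroup (Subgroup.zpowers h)).exists_card_eq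
  have hcard := (Subgroup.zpowers h).card_mul_index
  rw [hh] at hcard
  rw [← hcard, Nat.mul_div_cancel _ hp.out.pos, hm]
  obtain ⟨f, hf⟩ := Subgroup.exists_monoidHom_ker_eq hh
  obtain ⟨a, ha⟩ := Subgroup.exists_notMem_of_index_eq hh
  obtain ⟨y, hy, hay⟩ := hG.exists_pow_eq_pow (h := h) (g := a)
    (by rw [← hf]; exact monoidHom_pow_eq_one f a) (Subgroup.mem_zpowers_comm_of_index_eq hnc hh)
  refine augmentationSubmodule_pow_eq_bot_of_closure_pair hN (hG.exists_conj_eq_mul_pow hN)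
    ?_ hy hay ?_
  · have hle : Subgroup.zpowers h ≤ Subgroup.closure {h, a} :=
      Subgroup.zpowers_le.2 (Subgroup.subset_closure (by simp))
    have h1 := Subgroup.relIndex_mul_index hle
    rw [hh] at h1
    rcases (Nat.dvd_prime hp.out).1 (Dvd.intro_left _ h1) with h2 | h2
    · exact Subgroup.index_eq_one.1 h2
    · rw [h2] at h1
      have h4 := Nat.eq_of_mul_eq_mul_right hp.out.pos (h1.trans (one_mul p).symm)
      exact absurd (Subgroup.relIndex_eq_one.1 h4 (Subgroup.subset_closure (by simp))) ha
  · rw [← hm, Nat.card_zpowers, pow_orderOf_eq_one]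

theorem exists_productOneFreeM_of_index_eq {h : G}
    [(Subgroup.zpowers h).Normal] (hh : (Subgroup.zpowers h).index = p) :
    ∃ s : Multiset G, ProductOneFreeM s ∧ Multiset.card s + 1 = Nat.card G / p + p - 1 := by
  classical
  obtain ⟨f, hf⟩ := Subgroup.exists_monoidHom_ker_eq hh
  have hfh : f h = 1 := by
    rw [← MonoidHom.mem_ker, hf]; exact Subgroup.mem_zpowers h
  obtain ⟨a, ha⟩ := Subgroup.exists_notMem_of_index_eq hh
  have hne : h ≠ a := fun e => ha (e ▸ Subgroup.mem_zpowers h)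
  have hfa : f a ≠ 1 := by rwa [← hf, MonoidHom.mem_ker] at ha
  have hcard := (Subgroup.zpowers h).card_mul_index
  rw [hh, Nat.card_zpowers] at hcard
  have h2 := hp.out.two_le
  have hpos := orderOf_pos h
  refine ⟨.replicate (orderOf h - 1) h + .replicate (p - 1) a, ?_, ?_⟩
  · intro t ht ht0 l hl hprod
    subst hl
    have hmem : ∀ x ∈ l, x = h ∨ x = a := fun x hx => by
      have := Multiset.mem_of_le ht (Multiset.mem_coe.2 hx)
      rw [Multiset.mem_add] at this
      exact this.imp Multiset.eq_of_mem_replicate Multiset.eq_of_mem_replicate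
    have hca : l.count a ≤ p - 1 := by
      have := Multiset.count_le_of_le a ht
      simpa [Multiset.count_replicate, hne] using this
    have hch : l.count h ≤ orderOf h - 1 := by
      have := Multiset.count_le_of_le h ht
      simpa [Multiset.count_replicate, hne.symm] using this
    have hfl := f.map_list_prod_eq_pow_count hfh hne l hmem
    rw [hprod, map_one] at hfl
    have hord : orderOf (f a) = p :=
      orderOf_eq_prime (Multiplicative.toAdd.injective (by simp)) hfa
    have hdvd := orderOf_dvd_of_pow_eq_one hfl.symm
    rw [hord] at hdvd
    have hca0 := Nat.eq_zero_of_dvd_of_lt hdvd (by omega)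
    have hall : ∀ x ∈ l, x = h := fun x hx => (hmem x hx).resolve_right fun e =>
      List.count_eq_zero.1 hca0 (e ▸ hx)
    rw [List.eq_replicate_of_mem hall, List.prod_replicate] at hprod
    rw [List.eq_replicate_of_mem hall, List.count_replicate_self] at hch
    have hlen := Nat.eq_zero_of_dvd_of_lt (orderOf_dvd_of_pow_eq_one hprod) (by omega)
    exact ht0 (by simpa using hlen)
  · rw [← hcard, Nat.mul_div_cancel _ hp.out.pos]
    simp only [Multiset.card_add, Multiset.card_replicate]
    omega

end CyclicMaximal

section NoCyclicMaximal

theorem augmentationSubmodule_pow_eq_bot_mono {p : ℕ} {G : Type*} [Group G] {m n : ℕ}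
    (h : augmentationSubmodule p G ^ m = ⊥) (hmn : m ≤ n) : augmentationSubmodule p G ^ n = ⊥ :=
  pow_eq_zero_of_le hmn h

variable {p : ℕ} [hp : Fact p.Prime] {G : Type*} [Group G]
  {f : Fin 2 → G →* Multiplicative (ZMod p)} {a b h : G}

theorem pow_mem_iInf_ker (f : Fin 2 → G →* Multiplicative (ZMod p)) (g : G) :
    g ^ p ∈ ⨅ k, (f k).ker := by
  simp only [Subgroup.mem_iInf, MonoidHom.mem_ker]
  exact fun k => monoidHom_pow_eq_one (f k) g

theorem Subgroup.mem_zpowers_comm_of_index_eq_sq (hnc : ¬ IsCyclic G)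
    (hno : ∀ H : Subgroup G, IsCyclic H → H.index ≠ p)
    (hh : (zpowers h).index = p ^ 2) {g : G} (hg : h ∈ zpowers g) : g ∈ zpowers h := by
  have hle : zpowers h ≤ zpowers g := zpowers_le.2 hg
  have h1 := relIndex_mul_index hle
  rw [hh] at h1
  obtain ⟨i, hi, h2⟩ := (Nat.dvd_prime_pow hp.out).1 (Dvd.intro_left _ h1)
  interval_cases i
  · exact absurd (isCyclic_iff_exists_zpowers_eq_top.2 ⟨g, index_eq_one.1 h2⟩) hnc
  · exact absurd (h2.trans (pow_one p)) (hno _ inferInstance)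
  · rw [h2] at h1
    have h4 := Nat.eq_of_mul_eq_mul_right (pow_pos hp.out.pos 2) (h1.trans (one_mul _).symm)
    exact relIndex_eq_one.1 h4 (mem_zpowers g)

/-- A commutator is a square in a cyclic subgroup containing square roots of all squares. -/
theorem commutator_eq_sq_of_sq_eq_sq {y₁ y₂ y₃ : G} (h₁ : b ^ 2 = y₁ ^ 2)
    (h₂ : (b⁻¹ * a) ^ 2 = y₂ ^ 2) (h₃ : a⁻¹ ^ 2 = y₃ ^ 2)
    (m₁ : y₁ ∈ Subgroup.zpowers h) (m₂ : y₂ ∈ Subgroup.zpowers h)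
    (m₃ : y₃ ∈ Subgroup.zpowers h) : b * a * b⁻¹ * a⁻¹ = (y₁ * y₂ * y₃) ^ 2 := by
  obtain ⟨i, rfl⟩ := m₁
  obtain ⟨j, rfl⟩ := m₂
  obtain ⟨k, rfl⟩ := m₃
  calc b * a * b⁻¹ * a⁻¹ = b ^ 2 * (b⁻¹ * a) ^ 2 * a⁻¹ ^ 2 := by simp only [sq]; group
    _ = _ := by
      rw [h₁, h₂, h₃]
      simp only [← zpow_natCast, ← zpow_mul, ← zpow_add]
      congr 1; ring

variable [Finite G]

theorem IsPGroup.augmentationSubmodule_pow_eq_bot_of_iInf_ker (hG : IsPGroup p G)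
    (hnc : ¬ IsCyclic G) (hno : ∀ H : Subgroup G, IsCyclic H → H.index ≠ p)
    (h0a : f 0 a ≠ 1) (h1a : f 1 a = 1) (h0b : f 0 b = 1) (h1b : f 1 b ≠ 1)
    (hf : Subgroup.zpowers h = ⨅ k, (f k).ker) :
    augmentationSubmodule p G ^ (Nat.card G / p + p - 2) = ⊥ := by
  have hN : (Subgroup.zpowers h).Normal := by
    rw [hf]; exact Subgroup.normal_iInf_normal fun k => inferInstance
  have hindex : (Subgroup.zpowers h).index = p ^ 2 := by
    rw [hf]; exact Subgroup.index_iInf_ker h0a h1a h0b h1b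
  have hmax : ∀ g : G, h ∈ Subgroup.zpowers g → g ∈ Subgroup.zpowers h := fun g =>
    Subgroup.mem_zpowers_comm_of_index_eq_sq hnc hno hindex
  have hpow : ∀ g : G, ∃ y ∈ Subgroup.zpowers h, g ^ p = y ^ p := fun g =>
    hG.exists_pow_eq_pow (by rw [hf]; exact pow_mem_iInf_ker f g) (hmax g)
  have hgen : Subgroup.closure {h, a, b} = ⊤ := by
    rw [eq_top_iff, ← Subgroup.closure_pair_union_iInf_ker h0a h1a h0b h1b, ← hf]
    refine sup_le (Subgroup.closure_mono (by simp)) (Subgroup.zpowers_le.2 ?_)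
    exact Subgroup.subset_closure (by simp)
  obtain ⟨m, hm⟩ := (hG.to_subgroup (Subgroup.zpowers h)).exists_card_eq
  have hm0 : m ≠ 0 := by
    rintro rfl
    rw [pow_zero, Nat.card_zpowers, orderOf_eq_one_iff] at hm
    have ha := hmax a (hm ▸ one_mem _)
    rw [hf] at ha
    simp only [Subgroup.mem_iInf, MonoidHom.mem_ker] at ha
    exact h0a (ha 0)
  have hcard := (Subgroup.zpowers h).card_mul_index
  rw [hindex, hm] at hcard
  have hdiv : Nat.card G / p = p ^ m * p := by
    rw [← hcard, sq, ← mul_assoc, Nat.mul_div_cancel _ hp.out.pos]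
  rw [Nat.card_zpowers] at hm
  have hh : h ^ p ^ m = 1 := by rw [← hm, pow_orderOf_eq_one]
  have hle : p ≤ p ^ m := Nat.le_self_pow hm0 p
  have h2 := hp.out.two_le
  obtain ⟨y, hy, hay⟩ := hpow a
  obtain ⟨z, hz, hbz⟩ := hpow b
  have hab : b * a = b * a * b⁻¹ * a⁻¹ * (a * b) := by group
  rw [hdiv]
  rcases h2.eq_or_lt with rfl | h3
  · obtain ⟨w, hw, haw⟩ := hpow (b⁻¹ * a)
    obtain ⟨v, hv, hav⟩ := hpow a⁻¹
    refine augmentationSubmodule_pow_eq_bot_mono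
      (augmentationSubmodule_pow_eq_bot_of_closure_triple (e := 1) hN
        (hG.exists_conj_eq_mul_pow hN) hgen hy hay hz hbz hab le_rfl ?_ hh) (by omega)
    rw [commutator_eq_sq_of_sq_eq_sq hbz haw hav hz hw hv]
    exact of_pow_sub_one_mem (mul_mem (mul_mem hz hw) hv)
  · refine augmentationSubmodule_pow_eq_bot_mono
      (augmentationSubmodule_pow_eq_bot_of_closure_triple (e := 0) hN
        (hG.exists_conj_eq_mul_pow hN) hgen hy hay hz hbz hab zero_le_one ?_ hh) ?_
    · rw [pow_zero, mul_one]
      refine of_sub_one_mem_rightIdealOf ?_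
      rw [hf]
      simp [Subgroup.mem_iInf, MonoidHom.mem_ker, mul_comm]
    · have h4 : 3 * p ^ m ≤ p ^ m * p := by rw [mul_comm]; exact Nat.mul_le_mul_left _ h3
      omega

end NoCyclicMaximal

section MainBound

variable {p : ℕ} [hp : Fact p.Prime]

theorem IsPGroup.not_productOneFreeM_of_le_card.{u} (n : ℕ) : ∀ (G : Type u) [Group G] [Finite G],
    Nat.card G = n → IsPGroup p G → ¬ IsCyclic G →
      (∀ s : Multiset G, Nat.card G / p + p - 1 ≤ Multiset.card s → ¬ ProductOneFreeM s) ∧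
      ((∀ H : Subgroup G, IsCyclic H → H.index ≠ p) →
        ∀ s : Multiset G, Nat.card G / p + p - 2 ≤ Multiset.card s → ¬ ProductOneFreeM s) := by
  induction n using Nat.strong_induction_on with | _ n ih
  intro G _ _ hn hG hnc
  have h2 := hp.out.two_le
  have hmain : (∀ H : Subgroup G, IsCyclic H → H.index ≠ p) →
      ∀ s : Multiset G, Nat.card G / p + p - 2 ≤ Multiset.card s → ¬ ProductOneFreeM s := by
    intro hno s hs
    obtain ⟨f, a, b, h0a, h1a, h0b, h1b⟩ := hG.exists_two_monoidHom hnc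
    by_cases hN : IsCyclic (⨅ k, (f k).ker : Subgroup G)
    · obtain ⟨h, hh⟩ := (Subgroup.isCyclic_iff_exists_zpowers_eq_top _).1 hN
      exact not_productOneFreeM_of_pow_eq_bot
        (hG.augmentationSubmodule_pow_eq_bot_of_iInf_ker hnc hno h0a h1a h0b h1b hh) hs
    have hNp := hG.to_subgroup (⨅ k, (f k).ker)
    have hcard := (⨅ k, (f k).ker : Subgroup G).card_mul_index
    rw [Subgroup.index_iInf_ker h0a h1a h0b h1b] at hcard
    have hlt : Nat.card (⨅ k, (f k).ker : Subgroup G) < n := by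
      rw [← hn, ← hcard]
      exact lt_mul_of_one_lt_right Nat.card_pos (Nat.one_lt_pow two_ne_zero hp.out.one_lt)
    refine not_productOneFreeM_of_subgroup f _ (fun g hg => ?_)
      (ih _ hlt _ rfl hNp hN).1 s (le_trans ?_ hs)
    · simpa [Subgroup.mem_iInf, MonoidHom.mem_ker] using hg
    obtain ⟨j, hj⟩ := hNp.exists_card_eq
    match j with
    | 0 =>
      rw [pow_zero, Nat.card_eq_one_iff_unique] at hj
      have := hj.1
      exact absurd isCyclic_of_subsingleton hN
    | 1 => exact absurd (isCyclic_of_prime_card (hj.trans (pow_one p))) hN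
    | i + 2 =>
      have hd : Nat.card G / p = p ^ (i + 3) := by
        rw [← hcard, hj]
        exact Nat.div_eq_of_eq_mul_left hp.out.pos (by ring)
      have hd' : p ^ (i + 2) / p = p ^ (i + 1) :=
        Nat.div_eq_of_eq_mul_left hp.out.pos (by ring)
      rw [hj, hd, hd', Nat.add_sub_assoc hp.out.one_le, mul_add, Nat.mul_sub, mul_one]
      have e1 : p * p ^ (i + 1) = p ^ (i + 2) := by ring
      have e2 : p ^ (i + 3) = p ^ (i + 2) * p := by ring
      have e3 : p * p ≤ p ^ (i + 2) := by
        rw [← sq]; exact Nat.pow_le_pow_right hp.out.pos (by omega)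
      have e4 : p ^ (i + 2) * 2 ≤ p ^ (i + 2) * p := Nat.mul_le_mul_left _ h2
      have e5 : p ≤ p * p := Nat.le_mul_self p
      omega
  refine ⟨fun s hs => ?_, hmain⟩
  by_cases hno : ∀ H : Subgroup G, IsCyclic H → H.index ≠ p
  · exact hmain hno s (by omega)
  · push Not at hno
    obtain ⟨H, hH, hindex⟩ := hno
    obtain ⟨h, rfl⟩ := (Subgroup.isCyclic_iff_exists_zpowers_eq_top _).1 hH
    exact not_productOneFreeM_of_pow_eq_bot
      (hG.augmentationSubmodule_pow_eq_bot_of_index_eq hnc hindex) hs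

variable {G : Type*} [Group G] [Finite G]

theorem IsPGroup.exists_card_eq_smallDavenport (hG : IsPGroup p G) (hnc : ¬ IsCyclic G) :
    BddAbove {n : ℕ | ∃ s : Multiset G, ProductOneFreeM s ∧ Multiset.card s = n} ∧
      ∃ s : Multiset G, ProductOneFreeM s ∧ Multiset.card s = smallDavenport G := by
  have hbdd : BddAbove {n : ℕ | ∃ s : Multiset G, ProductOneFreeM s ∧ Multiset.card s = n} := by
    refine ⟨Nat.card G / p + p - 1, ?_⟩
    rintro _ ⟨s, hs, rfl⟩
    by_contra! hlt
    exact (IsPGroup.not_productOneFreeM_of_le_card _ G rfl hG hnc).1 s hlt.le hs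
  have hne : {n : ℕ | ∃ s : Multiset G, ProductOneFreeM s ∧ Multiset.card s = n}.Nonempty :=
    ⟨0, 0, fun t ht ht0 => absurd (Multiset.le_zero.1 ht) ht0, rfl⟩
  exact ⟨hbdd, Nat.sSup_mem hne hbdd⟩

theorem IsPGroup.davenport_loewy_eq_of_cyclic_index (hG : IsPGroup p G) (hnc : ¬ IsCyclic G) {h : G}
    (hh : (Subgroup.zpowers h).index = p) :
    smallDavenport G + 1 = orderedDavenport G ∧ orderedDavenport G = loewyLength p G ∧
      loewyLength p G = Nat.card G / p + p - 1 := by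
  have hm := hG.augmentationSubmodule_pow_eq_bot_of_index_eq hnc hh
  have := hG.normal_of_index_eq hh
  obtain ⟨s, hs, hcard⟩ := exists_productOneFreeM_of_index_eq hh
  obtain ⟨hbdd, t, ht, htcard⟩ := hG.exists_card_eq_smallDavenport hnc
  have h1 : Multiset.card s ≤ smallDavenport G := le_csSup hbdd ⟨s, hs, rfl⟩
  have h2 : smallDavenport G < orderedDavenport G := by
    by_contra! hle
    induction t using Quotient.inductionOn with | _ l
    have hmem : orderedDavenport G ∈
        {k : ℕ | ∀ l : List G, k ≤ l.length → ¬ OrderedProductOneFree l} :=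
      Nat.sInf_mem ⟨_, fun l hl => not_orderedProductOneFree_of_pow_eq_bot hm hl⟩
    exact hmem l (hle.trans htcard.ge) ht.orderedProductOneFree
  have hL : loewyLength p G ∈ {n : ℕ | 0 < n ∧
      (Ideal.jacobson (⊥ : Ideal (MonoidAlgebra (ZMod p) G))) ^ n = ⊥} ∧
      loewyLength p G ≤ Nat.card G / p + p - 1 := by
    have hmem : Nat.card G / p + p - 1 ∈ {n : ℕ | 0 < n ∧
      (Ideal.jacobson (⊥ : Ideal (MonoidAlgebra (ZMod p) G))) ^ n = ⊥} :=
      ⟨by omega, (jacobson_bot_pow_eq_bot_iff hm (by omega)).2 hm⟩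
    exact ⟨Nat.sInf_mem ⟨_, hmem⟩, Nat.sInf_le hmem⟩
  have h3 : orderedDavenport G ≤ loewyLength p G := Nat.sInf_le fun l hl =>
    not_orderedProductOneFree_of_pow_eq_bot
      ((jacobson_bot_pow_eq_bot_iff hm hL.1.1.ne').1 hL.1.2) hl
  have h4 := hL.2
  omega

end MainBound

/-- Let `p` be a prime and `G` a finite non-cyclic `p`-group. Then `G`
has a cyclic subgroup of index `p` if and only if
`d(G) + 1 = D_o(G) = L(G) = |G|/p + p - 1`. -/
theorem cyclic_index_p_iff_davenport_loewy (p : ℕ) (hp : p.Prime)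
    (G : Type*) [Group G] [Fintype G] (hpG : IsPGroup p G) (hnc : ¬ IsCyclic G) :
    (∃ H : Subgroup G, IsCyclic H ∧ H.index = p) ↔
      (smallDavenport G + 1 = orderedDavenport G ∧
       orderedDavenport G = loewyLength p G ∧
       loewyLength p G = Fintype.card G / p + p - 1) := by
  have : Fact p.Prime := ⟨hp⟩
  rw [← Nat.card_eq_fintype_card]
  constructor
  · rintro ⟨H, hH, hindex⟩
    obtain ⟨h, rfl⟩ := (Subgroup.isCyclic_iff_exists_zpowers_eq_top _).1 hH
    exact hpG.davenport_loewy_eq_of_cyclic_index hnc hindex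
  · rintro ⟨h1, h2, h3⟩
    by_contra! hno
    obtain ⟨-, s, hs, hcard⟩ := hpG.exists_card_eq_smallDavenport hnc
    exact (IsPGroup.not_productOneFreeM_of_le_card _ G rfl hpG hnc).2 hno s (by omega) hs
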